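/- arXiv:1405.3740 — 3 statements merged into one kernel-verified Lean document; each statement's English description precedes it below -/
import Mathlib

section
/- Let A, B be symmetric 3×3 real matrices, H₁(x) = xᵀAx, H₂(x) = xᵀBx, and let f(x) = ∇H₁(x) × ∇H₂(x) = (2Ax) × (2Bx) be the Nambu vector field on ℝ³. Let C = A·adj(B)·A and H₃(x) = xᵀCx. Fix h ∈ ℝ and x ∈ ℝ³ such that I - (h/2)f'(x) is invertible, and let x' = x + h(I - (h/2)f'(x))⁻¹ f(x) be the Kahan update. Then H₁(x')/(1 + 4h²H₃(x')) = H₁(x)/(1 + 4h²H₃(x)) and H₂(x')/(1 + 4h²H₃(x')) = H₂(x)/(1 + 4h²H₃(x)), provided the denominators are nonzero. -/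
open Matrix

lemma kn_symm_dot (A : Matrix (Fin 3) (Fin 3) ℝ) (hA : A.IsSymm) (u v : Fin 3 → ℝ) :
    u ⬝ᵥ A.mulVec v = v ⬝ᵥ A.mulVec u := by
  rw [dotProduct_mulVec, ← mulVec_transpose, hA.eq, dotProduct_comm]

lemma kn_cross_adj (B : Matrix (Fin 3) (Fin 3) ℝ) (hB : B.IsSymm) (u v : Fin 3 → ℝ) :
    crossProduct (B.mulVec u) (B.mulVec v) = B.adjugate.mulVec (crossProduct u v) := by
  have h1 := hB.apply 0 1
  have h2 := hB.apply 0 2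
  have h3 := hB.apply 1 2
  rw [Matrix.adjugate_fin_three]
  ext i
  fin_cases i <;>
    simp [cross_apply, mulVec, dotProduct, Fin.sum_univ_three, h1, h2, h3] <;> ring

lemma kn_adj_symm (B : Matrix (Fin 3) (Fin 3) ℝ) (hB : B.IsSymm) : B.adjugate.IsSymm := by
  rw [Matrix.IsSymm, Matrix.adjugate_transpose, hB.eq]

lemma kn_step1 (a b a' b' d : Fin 3 → ℝ) (c : ℝ)
    (hd : d = c • (crossProduct a b' + crossProduct a' b)) :
    d ⬝ᵥ (a + a') = c * (crossProduct a' a ⬝ᵥ (b' - b)) := by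
  subst hd
  simp [cross_apply, dotProduct, Fin.sum_univ_three]
  ring

lemma kn_triple (a w z : Fin 3 → ℝ) :
    w ⬝ᵥ crossProduct a z = a ⬝ᵥ crossProduct z w := by
  simp [cross_apply, dotProduct, Fin.sum_univ_three]
  ring

lemma kn_bac (x a a' : Fin 3 → ℝ) :
    crossProduct x (crossProduct a' a) = (x ⬝ᵥ a) • a' - (x ⬝ᵥ a') • a := by
  ext i
  fin_cases i <;> simp [cross_apply, dotProduct, Fin.sum_univ_three] <;> ring

lemma kn_key (A B : Matrix (Fin 3) (Fin 3) ℝ) (hA : A.IsSymm) (hB : B.IsSymm)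
    (x x' : Fin 3 → ℝ) (c : ℝ)
    (hd : x' - x = c • (crossProduct (A.mulVec x) (B.mulVec x')
      + crossProduct (A.mulVec x') (B.mulVec x))) :
    x' ⬝ᵥ A.mulVec x' - x ⬝ᵥ A.mulVec x = c ^ 2 *
      ((x ⬝ᵥ A.mulVec x) * (A.mulVec x' ⬝ᵥ B.adjugate.mulVec (A.mulVec x'))
      - (x' ⬝ᵥ A.mulVec x') * (A.mulVec x ⬝ᵥ B.adjugate.mulVec (A.mulVec x))) := by
  have e0 : x' ⬝ᵥ A.mulVec x' - x ⬝ᵥ A.mulVec x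
      = (x' - x) ⬝ᵥ (A.mulVec x + A.mulVec x') := by
    rw [sub_dotProduct, dotProduct_add, dotProduct_add, kn_symm_dot A hA x x']
    ring
  have e2 : crossProduct (A.mulVec x') (A.mulVec x) ⬝ᵥ (B.mulVec x' - B.mulVec x)
      = (x' - x) ⬝ᵥ B.mulVec (crossProduct (A.mulVec x') (A.mulVec x)) := by
    rw [← mulVec_sub, kn_symm_dot B hB]
  have s1 := kn_symm_dot A hA x x'
  have s2 := kn_symm_dot _ (kn_adj_symm B hB) (A.mulVec x) (A.mulVec x')
  rw [e0, kn_step1 _ _ _ _ _ c hd, e2, hd, smul_dotProduct, dotProduct_comm, dotProduct_add,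
    kn_triple (A.mulVec x) _ (B.mulVec x'), kn_triple (A.mulVec x') _ (B.mulVec x),
    kn_cross_adj B hB, kn_cross_adj B hB, kn_bac, kn_bac]
  simp only [mulVec_sub, mulVec_smul, dotProduct_sub, dotProduct_smul, smul_eq_mul]
  rw [s1, s2]
  ring

lemma kn_quot (a b a' b' x x' : Fin 3 → ℝ) (c : ℝ)
    (h1 : x ⬝ᵥ a' = x' ⬝ᵥ a) (h2 : x ⬝ᵥ b' = x' ⬝ᵥ b)
    (hd : x' - x = c • (crossProduct a b' + crossProduct a' b))
    (e1 : x' ⬝ᵥ a' - x ⬝ᵥ a = c * (crossProduct a' a ⬝ᵥ (b' - b)))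
    (e2 : x' ⬝ᵥ b' - x ⬝ᵥ b = c * (crossProduct b b' ⬝ᵥ (a' - a))) :
    (x' ⬝ᵥ a') * (x ⬝ᵥ b) = (x ⬝ᵥ a) * (x' ⬝ᵥ b') := by
  have f1 : x' ⬝ᵥ b - x ⬝ᵥ b = c * (b ⬝ᵥ crossProduct a b') := by
    rw [← sub_dotProduct, hd]
    simp [cross_apply, dotProduct, Fin.sum_univ_three]
    ring
  have f2 : x' ⬝ᵥ a - x ⬝ᵥ a = c * (a ⬝ᵥ crossProduct a' b) := by
    rw [← sub_dotProduct, hd]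
    simp [cross_apply, dotProduct, Fin.sum_univ_three]
    ring
  have rel : (x ⬝ᵥ a) * (a' ⬝ᵥ crossProduct b b') - (x ⬝ᵥ a') * (a ⬝ᵥ crossProduct b b')
      + (x ⬝ᵥ b) * (a ⬝ᵥ crossProduct a' b') - (x ⬝ᵥ b') * (a ⬝ᵥ crossProduct a' b) = 0 := by
    simp [cross_apply, dotProduct, Fin.sum_univ_three]
    ring
  have g1 : crossProduct a' a ⬝ᵥ (b' - b)
      = a ⬝ᵥ crossProduct a' b - a ⬝ᵥ crossProduct a' b' := by
    simp [cross_apply, dotProduct, Fin.sum_univ_three]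
    ring
  have g2 : crossProduct b b' ⬝ᵥ (a' - a)
      = a' ⬝ᵥ crossProduct b b' - a ⬝ᵥ crossProduct b b' := by
    simp [cross_apply, dotProduct, Fin.sum_univ_three]
    ring
  have g3 : b ⬝ᵥ crossProduct a b' = - (a ⬝ᵥ crossProduct b b') := by
    simp [cross_apply, dotProduct, Fin.sum_univ_three]
    ring
  rw [g1] at e1
  rw [g2] at e2
  rw [g3] at f1
  rw [h1, h2] at rel
  linear_combination (x ⬝ᵥ b) * e1 - (x ⬝ᵥ a) * e2 - c * rel
    - c * (a ⬝ᵥ crossProduct a' b) * f1 - c * (a ⬝ᵥ crossProduct b b') * f2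

lemma kn_adj_rel (A B : Matrix (Fin 3) (Fin 3) ℝ) (hA : A.IsSymm) (hB : B.IsSymm) :
    B * A.adjugate * B = A * B.adjugate * A - (A * B.adjugate).trace • A
      + (B * A.adjugate).trace • B := by
  have h1 := hB.apply 0 1
  have h2 := hB.apply 0 2
  have h3 := hB.apply 1 2
  have k1 := hA.apply 0 1
  have k2 := hA.apply 0 2
  have k3 := hA.apply 1 2
  rw [Matrix.adjugate_fin_three, Matrix.adjugate_fin_three]
  ext i j
  fin_cases i <;> fin_cases j <;>
    simp [Matrix.mul_apply, Matrix.trace, Fin.sum_univ_three, h1, h2, h3, k1, k2, k3] <;> ring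

lemma kn_quad (A C : Matrix (Fin 3) (Fin 3) ℝ) (hA : A.IsSymm) (x : Fin 3 → ℝ) :
    A.mulVec x ⬝ᵥ C.mulVec (A.mulVec x) = x ⬝ᵥ (A * C * A).mulVec x := by
  rw [dotProduct_comm, kn_symm_dot A hA, mulVec_mulVec, mulVec_mulVec, Matrix.mul_assoc]

lemma kn_fderiv (A B : Matrix (Fin 3) (Fin 3) ℝ)
    (f : (Fin 3 → ℝ) → (Fin 3 → ℝ))
    (hf : ∀ x, f x = crossProduct ((2 : ℝ) • A.mulVec x) ((2 : ℝ) • B.mulVec x))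
    (x v : Fin 3 → ℝ) :
    fderiv ℝ f x v = (4 : ℝ) • (crossProduct (A.mulVec v) (B.mulVec x)
      + crossProduct (A.mulVec x) (B.mulVec v)) := by
  have hdiff : DifferentiableAt ℝ f x := by
    have : f = fun x => crossProduct ((2 : ℝ) • A.mulVec x) ((2 : ℝ) • B.mulVec x) := funext hf
    rw [this, differentiableAt_pi]
    intro i
    fin_cases i <;> simp [cross_apply, mulVec, dotProduct, Fin.sum_univ_three] <;> fun_prop
  rw [← hdiff.lineDeriv_eq_fderiv]
  apply HasLineDerivAt.lineDeriv
  rw [HasLineDerivAt]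
  set g := (4 : ℝ) • (crossProduct (A.mulVec v) (B.mulVec x)
      + crossProduct (A.mulVec x) (B.mulVec v)) with hg
  have e : (fun t : ℝ => f (x + t • v)) = fun t : ℝ => f x + t • g + (t ^ 2) • f v := by
    funext t
    simp only [hf, hg, mulVec_add, mulVec_smul, map_add, map_smul, LinearMap.add_apply,
      LinearMap.smul_apply]
    module
  rw [e]
  have := (((hasDerivAt_id (0 : ℝ)).smul_const g).const_add (f x)).add
    (((hasDerivAt_id (0 : ℝ)).pow 2).smul_const (f v))
  simp at this
  exact this

/-- Kahan's method applied to the Nambu system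
`ẋ = ∇H₁ × ∇H₂` with `H₁ = xᵀAx`, `H₂ = xᵀBx` (A, B symmetric 3×3) preserves
`Hᵢ(x)/(1 + 4h²H₃(x))` for `i = 1,2`, where `H₃(x) = xᵀCx`, `C = A·adj(B)·A`. -/
theorem kahan_nambu_integrals (A B : Matrix (Fin 3) (Fin 3) ℝ)
    (hA : A.IsSymm) (hB : B.IsSymm)
    (f : (Fin 3 → ℝ) → (Fin 3 → ℝ))
    (hf : ∀ x, f x = crossProduct ((2 : ℝ) • A.mulVec x) ((2 : ℝ) • B.mulVec x))
    (H₁ H₂ H₃ : (Fin 3 → ℝ) → ℝ)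
    (hH₁ : ∀ x, H₁ x = x ⬝ᵥ A.mulVec x)
    (hH₂ : ∀ x, H₂ x = x ⬝ᵥ B.mulVec x)
    (hH₃ : ∀ x, H₃ x = x ⬝ᵥ (A * B.adjugate * A).mulVec x)
    (h : ℝ) (x x' : Fin 3 → ℝ)
    (hinv : IsUnit ((1 : (Fin 3 → ℝ) →L[ℝ] (Fin 3 → ℝ)) - (h/2) • fderiv ℝ f x))
    (hx' : x' = x + h • (Ring.inverse
      ((1 : (Fin 3 → ℝ) →L[ℝ] (Fin 3 → ℝ)) - (h/2) • fderiv ℝ f x)) (f x))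
    (hd : 1 + 4 * h^2 * H₃ x ≠ 0) (hd' : 1 + 4 * h^2 * H₃ x' ≠ 0) :
    H₁ x' / (1 + 4 * h^2 * H₃ x') = H₁ x / (1 + 4 * h^2 * H₃ x) ∧
    H₂ x' / (1 + 4 * h^2 * H₃ x') = H₂ x / (1 + 4 * h^2 * H₃ x) := by
  have hT : ((1 : (Fin 3 → ℝ) →L[ℝ] (Fin 3 → ℝ)) - (h/2) • fderiv ℝ f x) (x' - x)
      = h • f x := by
    have h1 : x' - x = h • (Ring.inverse
      ((1 : (Fin 3 → ℝ) →L[ℝ] (Fin 3 → ℝ)) - (h/2) • fderiv ℝ f x)) (f x) := by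
      rw [hx']; simp
    rw [h1, map_smul]
    have h2 := Ring.mul_inverse_cancel _ hinv
    have h3 := congrArg (fun L : (Fin 3 → ℝ) →L[ℝ] (Fin 3 → ℝ) => L (f x)) h2
    exact congrArg (fun y => h • y) h3
  have key : x' - x = (2 * h) • (crossProduct (A.mulVec x) (B.mulVec x')
      + crossProduct (A.mulVec x') (B.mulVec x)) := by
    have h4 : (x' - x) - (h/2) • fderiv ℝ f x (x' - x) = h • f x := hT
    rw [kn_fderiv A B f hf, sub_eq_iff_eq_add] at h4
    rw [h4, hf]
    simp only [mulVec_sub, map_sub, map_smul, LinearMap.sub_apply, LinearMap.smul_apply]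
    module
  have key2 : x' - x = (-(2 * h)) • (crossProduct (B.mulVec x) (A.mulVec x')
      + crossProduct (B.mulVec x') (A.mulVec x)) := by
    rw [key, ← cross_anticomm (A.mulVec x'), ← cross_anticomm (A.mulVec x)]
    module
  have K1 := kn_key A B hA hB x x' _ key
  have K2 := kn_key B A hB hA x x' _ key2
  have sA := kn_symm_dot A hA x x'
  have sB := kn_symm_dot B hB x x'
  have Q := kn_quot _ _ _ _ x x' _ sA sB key
    (by
      rw [← kn_step1 _ _ _ _ _ _ key, sub_dotProduct, dotProduct_add, dotProduct_add, sA]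
      ring)
    (by
      have := kn_step1 _ _ _ _ _ _ key2
      rw [sub_dotProduct, dotProduct_add, dotProduct_add, sB,
        ← cross_anticomm (B.mulVec x), neg_dotProduct] at this
      linear_combination this)
  simp only [kn_quad _ _ hA] at K1
  simp only [kn_quad _ _ hB, kn_adj_rel A B hA hB, add_mulVec, sub_mulVec, smul_mulVec,
    dotProduct_add, dotProduct_sub, dotProduct_smul, smul_eq_mul] at K2
  simp only [← hH₁, ← hH₂, ← hH₃] at K1 K2 Q
  constructor
  · rw [div_eq_div_iff hd' hd]
    linear_combination K1
  · rw [div_eq_div_iff hd' hd]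
    linear_combination K2 - 4 * h ^ 2 * (A * B.adjugate).trace * Q
end

section
/- Let x ∈ GL_n(ℝ) (or more generally a matrix such that I + hcx is invertible), c ∈ ℝ^{n×n}, h ∈ ℝ. Then x' := x(I + hcx)⁻¹ satisfies the Kahan equation for ẋ = -xcx, namely (x' - x)/h = -(1/2)(x c x' + x' c x). Consequently, when x is invertible, (x')⁻¹ = x⁻¹ + hc, and by induction the n-th iterate satisfies x_n = (x₀⁻¹ + nhc)⁻¹ (for constant c, whenever the inverses exist). -/
open Matrix

/-- For the matrix Riccati equation `ẋ = -xcx`, the matrix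
`x' = x(I + hcx)⁻¹` satisfies the Kahan equation `(x'-x)/h = -(1/2)(xcx' + x'cx)`;
when `x` is invertible, `(x')⁻¹ = x⁻¹ + hc`, and the `N`-th Kahan iterate is
`x_N = (x₀⁻¹ + Nhc)⁻¹` whenever the inverses exist. -/
theorem kahan_matrix_riccati (n : ℕ) (c : Matrix (Fin n) (Fin n) ℝ) (h : ℝ)
    (hh : h ≠ 0) (x x' : Matrix (Fin n) (Fin n) ℝ)
    (hinv : IsUnit ((1 : Matrix (Fin n) (Fin n) ℝ) + h • (c * x)))
    (hx' : x' = x * ((1 : Matrix (Fin n) (Fin n) ℝ) + h • (c * x))⁻¹) :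
    ((1/h) • (x' - x) = -((1/2 : ℝ) • (x * c * x' + x' * c * x))) ∧
    (IsUnit x → x'⁻¹ = x⁻¹ + h • c) ∧
    (∀ K : Matrix (Fin n) (Fin n) ℝ → Matrix (Fin n) (Fin n) ℝ,
      (∀ m, K m = m * ((1 : Matrix (Fin n) (Fin n) ℝ) + h • (c * m))⁻¹) →
      ∀ (x₀ : Matrix (Fin n) (Fin n) ℝ) (N : ℕ), IsUnit x₀ →
        (∀ k : ℕ, k ≤ N → IsUnit (x₀⁻¹ + (k : ℝ) • h • c)) →
        K^[N] x₀ = (x₀⁻¹ + (N : ℝ) • h • c)⁻¹) := by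
  have key : ∀ y : Matrix (Fin n) (Fin n) ℝ, IsUnit y →
      y⁻¹ * ((1 : Matrix (Fin n) (Fin n) ℝ) + h • (c * y⁻¹))⁻¹ = (y + h • c)⁻¹ := by
    intro y hy
    have hd := (Matrix.isUnit_iff_isUnit_det y).mp hy
    rw [← Matrix.mul_inv_rev, add_mul, one_mul, smul_mul_assoc, mul_assoc,
      Matrix.nonsing_inv_mul y hd, mul_one]
  refine ⟨?_, ?_, ?_⟩
  · have hd := (Matrix.isUnit_iff_isUnit_det _).mp hinv
    have h1 := Matrix.mul_nonsing_inv _ hd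
    have h2 := Matrix.nonsing_inv_mul _ hd
    generalize ((1 : Matrix (Fin n) (Fin n) ℝ) + h • (c * x))⁻¹ = B at *
    subst hx'
    rw [add_mul, one_mul, smul_mul_assoc] at h1
    rw [mul_add, mul_one, mul_smul_comm] at h2
    have e1 : h • (x * c * (x * B)) = x - x * B := by
      rw [eq_sub_iff_add_eq', mul_assoc, ← mul_assoc c x B, ← mul_smul_comm, ← mul_add, h1, mul_one]
    have e2 : h • (x * B * c * x) = x - x * B := by
      rw [eq_sub_iff_add_eq', mul_assoc, mul_assoc x B, ← mul_smul_comm, ← mul_add, h2, mul_one]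
    have e1' : x * c * (x * B) = (1/h) • (x - x * B) := by
      rw [← e1, smul_smul, one_div, inv_mul_cancel₀ hh, one_smul]
    have e2' : x * B * c * x = (1/h) • (x - x * B) := by
      rw [← e2, smul_smul, one_div, inv_mul_cancel₀ hh, one_smul]
    rw [e1', e2']
    module
  · intro hx
    have hdx := (Matrix.isUnit_iff_isUnit_det x).mp hx
    have hd := (Matrix.isUnit_iff_isUnit_det _).mp hinv
    rw [hx', Matrix.mul_inv_rev, Matrix.nonsing_inv_nonsing_inv _ hd, add_mul, one_mul,
      smul_mul_assoc, mul_assoc, Matrix.mul_nonsing_inv x hdx, mul_one]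
  · intro K hK x₀ N hx₀ hk
    induction N with
    | zero =>
      simp [Matrix.nonsing_inv_nonsing_inv x₀ ((Matrix.isUnit_iff_isUnit_det x₀).mp hx₀)]
    | succ N ih =>
      rw [Function.iterate_succ_apply', ih (fun k hkN => hk k (by omega)), hK,
        key _ (hk N (by omega))]
      congr 1
      push_cast
      module
end

section
/- For the two-dimensional Suslov system ẋ = ℓ(x) J ∇H(x) on ℝ² with ℓ(x) = uᵀx a homogeneous linear function, J = [[0,1],[-1,0]], and H(x) = (1/2)xᵀAx a homogeneous quadratic (A symmetric), the quantity H̃(x) = H(x) + (h/4)ℓ(x)∇H(x)ᵀ(I - (h/2)ℓ(x)JA)⁻¹ J∇H(x) is invariant under the Kahan map x' = x + h(I - (h/2)f'(x))⁻¹f(x), where f(x) = ℓ(x)JAx, wherever the relevant matrices are invertible. -/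
open Matrix

/-- Closed form of the modified Hamiltonian: `H / (1 + s² det A)`. -/
theorem htil_closed (s a b c p q : ℝ)
    (hu : IsUnit ((1 : Matrix (Fin 2) (Fin 2) ℝ) - s • (!![0, 1; -1, 0] * !![a, b; b, c]))) :
    1 + s ^ 2 * (a * c - b ^ 2) ≠ 0 ∧
    (1/2) * (![p, q] ⬝ᵥ !![a, b; b, c].mulVec ![p, q]) +
      (s/2) * (!![a, b; b, c].mulVec ![p, q] ⬝ᵥ
        ((((1 : Matrix (Fin 2) (Fin 2) ℝ) - s • (!![0, 1; -1, 0] * !![a, b; b, c]))⁻¹ *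
          !![0, 1; -1, 0]).mulVec (!![a, b; b, c].mulVec ![p, q]))) =
    (1/2) * (a * p ^ 2 + 2 * b * p * q + c * q ^ 2) / (1 + s ^ 2 * (a * c - b ^ 2)) := by
  have hM : (1 : Matrix (Fin 2) (Fin 2) ℝ) - s • (!![0, 1; -1, 0] * !![a, b; b, c]) =
      !![1 - s * b, - (s * c); s * a, 1 + s * b] := by
    ext i j
    fin_cases i <;> fin_cases j <;> simp [Matrix.mul_apply, Fin.sum_univ_two]
  rw [hM] at hu ⊢
  have hd : (!![1 - s * b, - (s * c); s * a, 1 + s * b] : Matrix (Fin 2) (Fin 2) ℝ).det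
      = 1 + s ^ 2 * (a * c - b ^ 2) := by
    rw [Matrix.det_fin_two_of]; ring
  have h0 : 1 + s ^ 2 * (a * c - b ^ 2) ≠ 0 := by
    rw [← hd]
    exact ((Matrix.isUnit_iff_isUnit_det _).1 hu).ne_zero
  refine ⟨h0, ?_⟩
  rw [Matrix.inv_def, hd, Ring.inverse_eq_inv', Matrix.adjugate_fin_two_of]
  simp [Matrix.mulVec, dotProduct, Matrix.mul_apply, Fin.sum_univ_two, Matrix.vecHead, Matrix.vecTail]
  field_simp
  ring

/-- For the planar Suslov system `ẋ = ℓ(x) J ∇H(x)` with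
`ℓ(x) = uᵀx`, `J = [[0,1],[-1,0]]`, `H(x) = (1/2)xᵀAx` (`A` symmetric), the
modified Hamiltonian `H̃(x) = H(x) + (h/4)ℓ(x)∇H(x)ᵀ(I - (h/2)ℓ(x)JA)⁻¹J∇H(x)`
is invariant under the Kahan map `x' = x + h(I - (h/2)f'(x))⁻¹f(x)`,
where `f(x) = ℓ(x)JAx` and `f'(x) = JAx uᵀ + ℓ(x)JA`. -/
theorem kahan_suslov_2d_invariant (h : ℝ) (u : Fin 2 → ℝ)
    (A J : Matrix (Fin 2) (Fin 2) ℝ) (hA : A.IsSymm)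
    (hJ : J = !![0, 1; -1, 0])
    (f : (Fin 2 → ℝ) → (Fin 2 → ℝ))
    (hf : ∀ x, f x = (u ⬝ᵥ x) • (J * A).mulVec x)
    (Df : (Fin 2 → ℝ) → Matrix (Fin 2) (Fin 2) ℝ)
    (hDf : ∀ x, Df x = vecMulVec ((J * A).mulVec x) u + (u ⬝ᵥ x) • (J * A))
    (Htil : (Fin 2 → ℝ) → ℝ)
    (hHtil : ∀ x, Htil x = (1/2) * (x ⬝ᵥ A.mulVec x) +
      (h/4) * (u ⬝ᵥ x) * (A.mulVec x ⬝ᵥ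
        ((((1 : Matrix (Fin 2) (Fin 2) ℝ) - ((h/2) * (u ⬝ᵥ x)) • (J * A))⁻¹ * J).mulVec
          (A.mulVec x))))
    (x x' : Fin 2 → ℝ)
    (hinv : IsUnit ((1 : Matrix (Fin 2) (Fin 2) ℝ) - (h/2) • Df x))
    (hinv₁ : IsUnit ((1 : Matrix (Fin 2) (Fin 2) ℝ) - ((h/2) * (u ⬝ᵥ x)) • (J * A)))
    (hinv₂ : IsUnit ((1 : Matrix (Fin 2) (Fin 2) ℝ) - ((h/2) * (u ⬝ᵥ x')) • (J * A)))
    (hx' : x' = x + h • (((1 : Matrix (Fin 2) (Fin 2) ℝ) - (h/2) • Df x)⁻¹).mulVec (f x)) :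
    Htil x' = Htil x := by
  obtain ⟨a, b, c, rfl⟩ : ∃ a b c, A = !![a, b; b, c] := by
    refine ⟨A 0 0, A 0 1, A 1 1, ?_⟩
    ext i j
    fin_cases i <;> fin_cases j <;> simp
    exact hA.apply 0 1
  subst hJ
  obtain ⟨p, q, rfl⟩ : ∃ p q, x = ![p, q] := ⟨x 0, x 1, by ext i; fin_cases i <;> rfl⟩
  obtain ⟨p', q', rfl⟩ : ∃ p q, x' = ![p, q] := ⟨x' 0, x' 1, by ext i; fin_cases i <;> rfl⟩
  obtain ⟨v, w, rfl⟩ : ∃ p q, u = ![p, q] := ⟨u 0, u 1, by ext i; fin_cases i <;> rfl⟩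
  obtain ⟨n₁, e₁⟩ := htil_closed _ a b c p q hinv₁
  obtain ⟨n₂, e₂⟩ := htil_closed _ a b c p' q' hinv₂
  have hdet := (Matrix.isUnit_iff_isUnit_det _).1 hinv
  have key : ((1 : Matrix (Fin 2) (Fin 2) ℝ) - (h/2) • Df ![p, q]).mulVec
      (![p', q'] - ![p, q]) = h • f ![p, q] := by
    rw [hx', add_sub_cancel_left, Matrix.mulVec_smul, Matrix.mulVec_mulVec,
      Matrix.mul_nonsing_inv _ hdet, Matrix.one_mulVec]
  rw [hDf, hf] at key
  have k0 := congrFun key 0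
  have k1 := congrFun key 1
  have hs : ∀ t : ℝ, h / 4 * t = (h / 2 * t) / 2 := fun t => by ring
  rw [hHtil, hHtil, hs, hs, e₁, e₂, div_eq_div_iff n₂ n₁]
  have l₁ : ![v, w] ⬝ᵥ ![p, q] = v * p + w * q := by simp [dotProduct, Fin.sum_univ_two]
  have l₂ : ![v, w] ⬝ᵥ ![p', q'] = v * p' + w * q' := by simp [dotProduct, Fin.sum_univ_two]
  rw [l₁, l₂]
  simp [Matrix.mulVec, dotProduct, Matrix.mul_apply, Fin.sum_univ_two, Matrix.vecMulVec_apply,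
    Matrix.vecHead, Matrix.vecTail] at k0 k1
  obtain ⟨s, hs⟩ : ∃ s, s = h / 2 * (v * p + w * q) := ⟨_, rfl⟩
  obtain ⟨s', hs'⟩ : ∃ s, s = h / 2 * (v * p' + w * q') := ⟨_, rfl⟩
  rw [← hs, ← hs']
  have E0 : p' - s * (b * p' + c * q') = p + s' * (b * p + c * q) := by
    rw [hs, hs']; linear_combination k0
  have E1 : q' + s * (a * p' + b * q') = q - s' * (a * p + b * q) := by
    rw [hs, hs']; linear_combination k1
  have Q : a * (p' - s * (b * p' + c * q')) ^ 2
      + 2 * b * (p' - s * (b * p' + c * q')) * (q' + s * (a * p' + b * q'))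
      + c * (q' + s * (a * p' + b * q')) ^ 2
      = a * (p + s' * (b * p + c * q)) ^ 2
      + 2 * b * (p + s' * (b * p + c * q)) * (q - s' * (a * p + b * q))
      + c * (q - s' * (a * p + b * q)) ^ 2 := by
    rw [E0, E1]
  linear_combination (1/2) * Q
end
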